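/- arXiv:2411.14083 — 4 statements merged into one kernel-verified Lean document; each statement's English description precedes it below -/
import Mathlib

section
/- Let N ≥ 2, let K : ℕ₀×ℕ₀ → [0,∞) be a symmetric kernel, let (f_j^N)_{j=0}^N be a differentiable solution of the truncated EDG system at some time t, and let h_0, h_1, …, h_N be nonnegative real numbers. Then Σ_{j=0}^N h_j (d f_j^N/dt) = Σ_{j=1}^{N−1} (h_{j+1} − 2h_j + h_{j−1}) f_j^N Σ_{k=1}^{N−1} K_{j,k} f_k^N + Σ_{j=1}^{N−1} ((h_{j−1} − h_j) + (h_1 − h_0)) K_{j,0} f_j^N f_0^N + Σ_{j=1}^{N−1} ((h_{j+1} − h_j) + (h_{N−1} − h_N)) f_j^N K_{N,j} f_N^N + ((h_{N−1} − h_N) + (h_1 − h_0)) f_N^N K_{N,0} f_0^N. -/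
open MeasureTheory Filter

noncomputable section

/-- Membership in the positive cone `Y_r^+`: componentwise nonnegative sequences with
`∑ j^r f_j < ∞`. -/
def MemYplus (r : ℝ) (g : ℕ → ℝ) : Prop :=
  (∀ j, 0 ≤ g j) ∧ Summable (fun j : ℕ => (j : ℝ) ^ r * g j)

/-- The `p`-th moment `M_p(g) = ∑_{j=0}^∞ j^p g_j`. -/
def mom (p : ℝ) (g : ℕ → ℝ) : ℝ := ∑' j : ℕ, (j : ℝ) ^ p * g j

/-- Right-hand side of the infinite EDG system. -/
def edgRHS (K : ℕ → ℕ → ℝ) (g : ℕ → ℝ) : ℕ → ℝ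
  | 0 => g 1 * (∑' k : ℕ, K 1 k * g k) - g 0 * (∑' k : ℕ, K (k + 1) 0 * g (k + 1))
  | m + 1 =>
      g (m + 2) * (∑' k : ℕ, K (m + 2) k * g k) - g (m + 1) * (∑' k : ℕ, K (m + 1) k * g k)
        - g (m + 1) * (∑' k : ℕ, K (k + 1) (m + 1) * g (k + 1))
        + g m * (∑' k : ℕ, K (k + 1) m * g (k + 1))

/-- Mild solution of the EDG system on a time set `S` (containing `0`), with values in
`Y_r^+`. -/
def IsMildSolutionOn (K : ℕ → ℕ → ℝ) (r : ℝ) (f : ℝ → ℕ → ℝ) (S : Set ℝ) : Prop :=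
  (∀ t ∈ S, MemYplus r (f t)) ∧
  (∀ j : ℕ, ContinuousOn (fun t => f t j) S) ∧
  (∃ B : ℝ, ∀ t ∈ S, (∑' j : ℕ, (j : ℝ) ^ r * f t j) ≤ B) ∧
  (∀ t ∈ S, ∀ j : ℕ, Summable (fun k : ℕ => K j k * f t k)) ∧
  (∀ t ∈ S, ∀ j : ℕ,
    MeasureTheory.IntegrableOn (fun s => ∑' k : ℕ, K j k * f s k) (Set.Icc 0 t)) ∧
  (∀ t ∈ S, f t 0 = f 0 0 + ∫ s in (0:ℝ)..t,
      (f s 1 * (∑' k : ℕ, K 1 k * f s k) - f s 0 * (∑' k : ℕ, K (k + 1) 0 * f s (k + 1)))) ∧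
  (∀ t ∈ S, ∀ m : ℕ, f t (m + 1) = f 0 (m + 1) + ∫ s in (0:ℝ)..t,
      (f s (m + 2) * (∑' k : ℕ, K (m + 2) k * f s k)
        - f s (m + 1) * (∑' k : ℕ, K (m + 1) k * f s k)
        - f s (m + 1) * (∑' k : ℕ, K (k + 1) (m + 1) * f s (k + 1))
        + f s m * (∑' k : ℕ, K (k + 1) m * f s (k + 1))))

/-- Classical (continuously differentiable) solution of the EDG system on a time set `S`. -/
def IsClassicalSolutionOn (K : ℕ → ℕ → ℝ) (f : ℝ → ℕ → ℝ) (S : Set ℝ) : Prop :=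
  (∀ t ∈ S, ∀ j : ℕ, Summable (fun k : ℕ => K j k * f t k) ∧
      Summable (fun k : ℕ => K (k + 1) j * f t (k + 1))) ∧
  (∀ t ∈ S, ∀ j : ℕ, HasDerivWithinAt (fun s => f s j) (edgRHS K (f t) j) S t) ∧
  (∀ j : ℕ, ContinuousOn (fun t => edgRHS K (f t) j) S)

/-- Right-hand side of the truncated EDG system with `N+1` equations. -/
def truncRHS (K : ℕ → ℕ → ℝ) (N : ℕ) (g : ℕ → ℝ) (j : ℕ) : ℝ :=
  if j = 0 then
    g 1 * (∑ k ∈ Finset.range N, K 1 k * g k) - g 0 * (∑ k ∈ Finset.Icc 1 N, K k 0 * g k)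
  else if j = N then
    - g N * (∑ k ∈ Finset.range N, K N k * g k)
      + g (N - 1) * (∑ k ∈ Finset.Icc 1 N, K k (N - 1) * g k)
  else
    g (j + 1) * (∑ k ∈ Finset.range N, K (j + 1) k * g k)
      - g j * (∑ k ∈ Finset.range N, K j k * g k)
      - g j * (∑ k ∈ Finset.Icc 1 N, K k j * g k)
      + g (j - 1) * (∑ k ∈ Finset.Icc 1 N, K k (j - 1) * g k)

/-- `fN` is a (global, `C¹`) solution of the truncated EDG system of size `N`. -/
def IsTruncSolution (K : ℕ → ℕ → ℝ) (N : ℕ) (fN : ℝ → ℕ → ℝ) : Prop :=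
  ∀ t : ℝ, ∀ j ≤ N, HasDerivAt (fun s => fN s j) (truncRHS K N (fN t) j) t

/-- The gelation time `T_gel = inf { t ≥ 0 : ∑ j f_j(t) < ∑ j f_j(0) }`. -/
def gelTime (f : ℝ → ℕ → ℝ) : ℝ :=
  sInf { t : ℝ | 0 ≤ t ∧ (∑' j : ℕ, (j : ℝ) * f t j) < ∑' j : ℕ, (j : ℝ) * f 0 j }

/-- The class `𝒢_{1,∞}`: a nonnegative convex `C²` function `G` on `[0,∞)` with derivative
`G'`, such that `G(0) = G'(0) = 0`, `G'` is concave and positive on `(0,∞)`, and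
`G'(x) → ∞`, `G(x)/x → ∞` as `x → ∞`. -/
structure G1Inf where
  G : ℝ → ℝ
  G' : ℝ → ℝ
  hasDeriv : ∀ x ∈ Set.Ici (0:ℝ), HasDerivWithinAt G (G' x) (Set.Ici 0) x
  contDiff : ContDiffOn ℝ 2 G (Set.Ici 0)
  nonneg : ∀ x ∈ Set.Ici (0:ℝ), 0 ≤ G x
  convex : ConvexOn ℝ (Set.Ici 0) G
  zero : G 0 = 0
  deriv_zero : G' 0 = 0
  concave_deriv : ConcaveOn ℝ (Set.Ici 0) G'
  deriv_pos : ∀ x : ℝ, 0 < x → 0 < G' x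
  tendsto_deriv : Filter.Tendsto G' Filter.atTop Filter.atTop
  tendsto_div : Filter.Tendsto (fun x => G x / x) Filter.atTop Filter.atTop

end

/-- Summation by parts for a system whose components exchange the fluxes `u` (downwards) and
`v` (upwards) with their neighbours, without flux through the two ends. -/
theorem sum_mul_flux_balance (h u v : ℕ → ℝ) (n : ℕ) :
    h 0 * (u 1 - v 0)
        + (∑ i ∈ Finset.range n,
            h (i + 1) * (u (i + 2) - u (i + 1) - v (i + 1) + v i))
        + h (n + 1) * (-u (n + 1) + v n)
      = (∑ i ∈ Finset.range (n + 1), (h i - h (i + 1)) * u (i + 1))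
        + ∑ i ∈ Finset.range (n + 1), (h (i + 1) - h i) * v i := by
  induction n with
  | zero => simp; ring
  | succ n ih =>
    rw [Finset.sum_range_succ, Finset.sum_range_succ _ (n + 1), Finset.sum_range_succ _ (n + 1)]
    linear_combination ih

theorem sum_Icc_one_eq_sum_range (F : ℕ → ℝ) (n : ℕ) :
    ∑ k ∈ Finset.Icc 1 n, F k = ∑ k ∈ Finset.range n, F (k + 1) := by
  rw [Finset.range_eq_Ico, Finset.sum_Ico_add' F 0 n 1]
  rfl

/-- The weighted sum of the truncated right-hand sides in terms of the exchange rates. -/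
theorem sum_mul_truncRHS (K : ℕ → ℕ → ℝ) (g h : ℕ → ℝ) (n : ℕ) :
    ∑ j ∈ Finset.range (n + 2), h j * truncRHS K (n + 1) g j
      = (∑ i ∈ Finset.range (n + 1), (h i - h (i + 1)) *
            (g (i + 1) * ∑ k ∈ Finset.range (n + 1), K (i + 1) k * g k))
        + ∑ i ∈ Finset.range (n + 1), (h (i + 1) - h i) *
            (g i * ∑ k ∈ Finset.range (n + 1), K (k + 1) i * g (k + 1)) := by
  rw [← sum_mul_flux_balance h (fun j => g j * ∑ k ∈ Finset.range (n + 1), K j k * g k)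
    (fun j => g j * ∑ k ∈ Finset.range (n + 1), K (k + 1) j * g (k + 1)) n,
    Finset.sum_range_succ, Finset.sum_range_succ']
  have hmid : ∀ i ∈ Finset.range n, h (i + 1) * truncRHS K (n + 1) g (i + 1)
      = h (i + 1) * (g (i + 2) * (∑ k ∈ Finset.range (n + 1), K (i + 2) k * g k)
        - g (i + 1) * (∑ k ∈ Finset.range (n + 1), K (i + 1) k * g k)
        - g (i + 1) * (∑ k ∈ Finset.range (n + 1), K (k + 1) (i + 1) * g (k + 1))
        + g i * (∑ k ∈ Finset.range (n + 1), K (k + 1) i * g (k + 1))) := by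
    intro i hi
    have hne : i ≠ n := (Finset.mem_range.mp hi).ne
    simp [truncRHS, hne, sum_Icc_one_eq_sum_range]
  rw [Finset.sum_congr rfl hmid]
  simp only [truncRHS, sum_Icc_one_eq_sum_range, if_true, Nat.add_sub_cancel,
    if_neg (Nat.succ_ne_zero n)]
  ring

/-- Lemma 3.1: divergence form of `∑ h_j ḟ_j^N` for the truncated system
with a symmetric kernel. -/
theorem trunc_divergence_form (N : ℕ) (hN : 2 ≤ N) (K : ℕ → ℕ → ℝ)
    (hKnn : ∀ j k : ℕ, 0 ≤ K j k) (hKsym : ∀ j k : ℕ, K j k = K k j)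
    (fN : ℝ → ℕ → ℝ) (t : ℝ) (d : ℕ → ℝ)
    (hderiv : ∀ j ≤ N, HasDerivAt (fun s => fN s j) (d j) t)
    (hode : ∀ j ≤ N, d j = truncRHS K N (fN t) j)
    (h : ℕ → ℝ) (hh : ∀ j ≤ N, 0 ≤ h j) :
    (∑ j ∈ Finset.range (N + 1), h j * d j) =
      (∑ j ∈ Finset.Icc 1 (N - 1), (h (j + 1) - 2 * h j + h (j - 1)) * fN t j *
        (∑ k ∈ Finset.Icc 1 (N - 1), K j k * fN t k))
      + (∑ j ∈ Finset.Icc 1 (N - 1), ((h (j - 1) - h j) + (h 1 - h 0)) * K j 0 * fN t j * fN t 0)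
      + (∑ j ∈ Finset.Icc 1 (N - 1),
          ((h (j + 1) - h j) + (h (N - 1) - h N)) * fN t j * K N j * fN t N)
      + ((h (N - 1) - h N) + (h 1 - h 0)) * fN t N * K N 0 * fN t 0 := by
  obtain ⟨m, rfl⟩ : ∃ m, N = m + 2 := ⟨N - 2, by omega⟩
  rw [Finset.sum_congr rfl fun j hj => by
    rw [hode j (Nat.lt_succ_iff.mp (Finset.mem_range.mp hj))]]
  rw [sum_mul_truncRHS K (fN t) h (m + 1)]
  generalize fN t = g
  have hpred : m + 2 - 1 = m + 1 := rfl
  simp only [hpred, sum_Icc_one_eq_sum_range, Nat.add_sub_cancel]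
  simp only [Finset.sum_range_succ' (fun k => K _ k * g k) (m + 1),
    Finset.sum_range_succ (fun k => K (k + 1) _ * g (k + 1)) (m + 1)]
  rw [Finset.sum_range_succ, Finset.sum_range_succ' _ (m + 1)]
  have hcol : ∀ i, ∑ k ∈ Finset.range (m + 1), K (k + 1) i * g (k + 1)
      = ∑ k ∈ Finset.range (m + 1), K i (k + 1) * g (k + 1) :=
    fun i => Finset.sum_congr rfl fun k _ => by rw [hKsym]
  have hterm : ∀ i ∈ Finset.range (m + 1),
      (h i - h (i + 1)) * (g (i + 1) *
          (∑ k ∈ Finset.range (m + 1), K (i + 1) (k + 1) * g (k + 1) + K (i + 1) 0 * g 0))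
        + (h (i + 2) - h (i + 1)) * (g (i + 1) *
          (∑ k ∈ Finset.range (m + 1), K (i + 1) (k + 1) * g (k + 1)
            + K (m + 2) (i + 1) * g (m + 2)))
        + (h 1 - h 0) * g 0 * (K (i + 1) 0 * g (i + 1))
        + (h (m + 1) - h (m + 2)) * g (m + 2) * (K (m + 2) (i + 1) * g (i + 1))
      = (h (i + 2) - 2 * h (i + 1) + h i) * g (i + 1) *
          (∑ k ∈ Finset.range (m + 1), K (i + 1) (k + 1) * g (k + 1))
        + ((h i - h (i + 1)) + (h 1 - h 0)) * K (i + 1) 0 * g (i + 1) * g 0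
        + ((h (i + 2) - h (i + 1)) + (h (m + 1) - h (m + 2))) * g (i + 1)
          * K (m + 2) (i + 1) * g (m + 2) :=
    fun i _ => by ring
  have hsum := Finset.sum_congr rfl hterm
  simp only [Finset.sum_add_distrib, ← Finset.mul_sum _ _ ((h 1 - h 0) * g 0),
    ← Finset.mul_sum _ _ ((h (m + 1) - h (m + 2)) * g (m + 2))] at hsum
  simp only [hcol, zero_add, Nat.add_assoc, Nat.reduceAdd]
  simp only [hKsym 0]
  linear_combination hsum
end

section
/- Let λ ≥ 1 and let (f_j(0))_{j≥0} be a nonnegative real sequence with Σ_{j=0}^∞ j^λ f_j(0) < ∞. Then there exists a function G ∈ 𝒢_{1,∞} such that Σ_{j=0}^∞ j^{λ−1} G(j) f_j(0) < ∞. In particular, for λ = 1 this gives: if Σ_{j=0}^∞ j f_j(0) < ∞, then there exists G ∈ 𝒢_{1,∞} with Σ_{j=0}^∞ G(j) f_j(0) < ∞. -/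
open MeasureTheory Filter

open Topology Set

/-- The superposition `x ↦ ∑ₖ arctan (cₖ x)`. -/
noncomputable def arctanSeries (c : ℕ → ℝ) (x : ℝ) : ℝ := ∑' k, Real.arctan (c k * x)

/-- The termwise derivative of `arctanSeries c`. -/
noncomputable def arctanSeriesDeriv (c : ℕ → ℝ) (x : ℝ) : ℝ := ∑' k, c k / (1 + (c k * x) ^ 2)

section ArctanSeries

variable {c : ℕ → ℝ}

theorem hasDerivAt_arctan_const_mul (a x : ℝ) :
    HasDerivAt (fun y => Real.arctan (a * y)) (a / (1 + (a * x) ^ 2)) x := by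
  have h := ((hasDerivAt_id x).const_mul a).arctan
  simp only [id, mul_one] at h
  convert h using 1
  ring

theorem norm_div_one_add_sq_le {a : ℝ} (ha : 0 < a) (x : ℝ) :
    ‖a / (1 + (a * x) ^ 2)‖ ≤ a := by
  rw [Real.norm_of_nonneg (by positivity)]
  exact div_le_self ha.le (by nlinarith [sq_nonneg (a * x)])

theorem summable_arctan_mul (hc : ∀ k, 0 < c k) (hs : Summable c) (x : ℝ) :
    Summable fun k => Real.arctan (c k * x) :=
  summable_of_summable_hasDerivAt hs (fun k y => hasDerivAt_arctan_const_mul (c k) y)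
    (fun k y => norm_div_one_add_sq_le (hc k) y) (y₀ := 0) (by simp [summable_zero]) x

theorem hasDerivAt_arctanSeries (hc : ∀ k, 0 < c k) (hs : Summable c) (x : ℝ) :
    HasDerivAt (arctanSeries c) (arctanSeriesDeriv c x) x :=
  hasDerivAt_tsum hs (fun k y => hasDerivAt_arctan_const_mul (c k) y)
    (fun k y => norm_div_one_add_sq_le (hc k) y) (y₀ := 0) (by simp [summable_zero]) x

theorem continuous_arctanSeriesDeriv (hc : ∀ k, 0 < c k) (hs : Summable c) :
    Continuous (arctanSeriesDeriv c) :=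
  continuous_tsum (fun k => by
    refine continuous_const.div (by fun_prop) fun x => ?_
    positivity) hs fun k y => norm_div_one_add_sq_le (hc k) y

theorem contDiff_arctanSeries (hc : ∀ k, 0 < c k) (hs : Summable c) :
    ContDiff ℝ 1 (arctanSeries c) := by
  rw [contDiff_one_iff_deriv]
  refine ⟨fun x => (hasDerivAt_arctanSeries hc hs x).differentiableAt, ?_⟩
  rw [show deriv (arctanSeries c) = arctanSeriesDeriv c from
    funext fun x => (hasDerivAt_arctanSeries hc hs x).deriv]
  exact continuous_arctanSeriesDeriv hc hs

theorem arctanSeries_zero : arctanSeries c 0 = 0 := by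
  simp [arctanSeries]

theorem monotone_arctanSeries (hc : ∀ k, 0 < c k) (hs : Summable c) :
    Monotone (arctanSeries c) := fun x y hxy =>
  (summable_arctan_mul hc hs x).tsum_le_tsum
    (fun k => Real.arctan_strictMono.monotone (mul_le_mul_of_nonneg_left hxy (hc k).le))
    (summable_arctan_mul hc hs y)

theorem sum_range_le_arctanSeries (hc : ∀ k, 0 < c k) (hs : Summable c) {x : ℝ} (hx : 0 ≤ x)
    (n : ℕ) : ∑ k ∈ Finset.range n, Real.arctan (c k * x) ≤ arctanSeries c x :=
  (summable_arctan_mul hc hs x).sum_le_tsum _ fun k _ =>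
    Real.arctan_nonneg.2 (mul_nonneg (hc k).le hx)

theorem arctanSeries_pos (hc : ∀ k, 0 < c k) (hs : Summable c) {x : ℝ} (hx : 0 < x) :
    0 < arctanSeries c x := by
  have h := sum_range_le_arctanSeries hc hs hx.le 1
  rw [Finset.sum_range_one] at h
  exact (Real.arctan_pos.2 (mul_pos (hc 0) hx)).trans_le h

theorem arctanSeriesDeriv_antitoneOn (hc : ∀ k, 0 < c k) (hs : Summable c) :
    AntitoneOn (arctanSeriesDeriv c) (Ici 0) := by
  intro x hx y _ hxy
  have hx' : (0 : ℝ) ≤ x := hx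
  have hsum : ∀ z, Summable fun k => c k / (1 + (c k * z) ^ 2) := fun z =>
    .of_norm_bounded hs fun k => norm_div_one_add_sq_le (hc k) z
  refine (hsum y).tsum_le_tsum (fun k => ?_) (hsum x)
  have := (hc k).le
  gcongr

theorem concaveOn_arctanSeries (hc : ∀ k, 0 < c k) (hs : Summable c) :
    ConcaveOn ℝ (Ici 0) (arctanSeries c) := by
  have hd := hasDerivAt_arctanSeries hc hs
  refine AntitoneOn.concaveOn_of_deriv (convex_Ici 0)
    (fun x _ => (hd x).continuousAt.continuousWithinAt)
    (fun x _ => (hd x).differentiableAt.differentiableWithinAt) ?_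
  rw [show deriv (arctanSeries c) = arctanSeriesDeriv c from funext fun x => (hd x).deriv]
  exact (arctanSeriesDeriv_antitoneOn hc hs).mono interior_subset

theorem tendsto_arctanSeries (hc : ∀ k, 0 < c k) (hs : Summable c) :
    Tendsto (arctanSeries c) atTop atTop := by
  refine tendsto_atTop.2 fun b => ?_
  obtain ⟨n, hn⟩ := exists_nat_gt b
  have hlim : Tendsto (fun x => ∑ k ∈ Finset.range n, Real.arctan (c k * x)) atTop
      (𝓝 (∑ _k ∈ Finset.range n, Real.pi / 2)) :=
    tendsto_finsetSum _ fun k _ => (tendsto_nhds_of_tendsto_nhdsWithin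
      Real.tendsto_arctan_atTop).comp (tendsto_id.const_mul_atTop (hc k))
  have hlt : b < ∑ _k ∈ Finset.range n, Real.pi / 2 := by
    rw [Finset.sum_const, Finset.card_range, nsmul_eq_mul]
    nlinarith [Real.pi_gt_three, (Nat.cast_nonneg n : (0 : ℝ) ≤ n)]
  filter_upwards [hlim.eventually_const_lt hlt, eventually_ge_atTop 0] with x hx hx0
  exact hx.le.trans (sum_range_le_arctanSeries hc hs hx0 n)

end ArctanSeries

section Primitive

variable {g : ℝ → ℝ}

theorem hasDerivAt_primitive (hg : Continuous g) (x : ℝ) :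
    HasDerivAt (fun y => ∫ t in (0 : ℝ)..y, g t) (g x) x :=
  intervalIntegral.integral_hasDerivAt_right (hg.intervalIntegrable 0 x)
    hg.stronglyMeasurable.stronglyMeasurableAtFilter hg.continuousAt

theorem primitive_le_mul (hg : Continuous g) (hm : Monotone g) {x : ℝ} (hx : 0 ≤ x) :
    ∫ t in (0 : ℝ)..x, g t ≤ x * g x := by
  have h := intervalIntegral.integral_mono_on hx (hg.intervalIntegrable (μ := volume) 0 x)
    (continuous_const.intervalIntegrable (μ := volume) 0 x) fun t ht => hm ht.2
  simpa using h

theorem mul_half_le_primitive (hg : Continuous g) (hm : Monotone g) (h0 : 0 ≤ g 0) {x : ℝ}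
    (hx : 0 ≤ x) : x / 2 * g (x / 2) ≤ ∫ t in (0 : ℝ)..x, g t := by
  have h1 : 0 ≤ ∫ t in (0 : ℝ)..(x / 2), g t :=
    intervalIntegral.integral_nonneg (by linarith) fun t ht => h0.trans (hm ht.1)
  have h2 := intervalIntegral.integral_mono_on (show x / 2 ≤ x by linarith)
    (continuous_const.intervalIntegrable (μ := volume) (x / 2) x)
    (hg.intervalIntegrable (μ := volume) (x / 2) x) fun t ht => hm ht.1
  rw [intervalIntegral.integral_const, smul_eq_mul, sub_half] at h2
  rw [← intervalIntegral.integral_add_adjacent_intervals (hg.intervalIntegrable 0 (x / 2))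
    (hg.intervalIntegrable (x / 2) x)]
  linarith

end Primitive

/-- The primitive of `arctanSeries c`, as a member of `𝒢_{1,∞}`. -/
noncomputable def G1Inf.ofArctanSeries (c : ℕ → ℝ) (hc : ∀ k, 0 < c k) (hs : Summable c) : G1Inf where
  G x := ∫ t in (0 : ℝ)..x, arctanSeries c t
  G' := arctanSeries c
  hasDeriv x _ := (hasDerivAt_primitive (contDiff_arctanSeries hc hs).continuous x).hasDerivWithinAt
  contDiff := by
    have hd := hasDerivAt_primitive (contDiff_arctanSeries hc hs).continuous
    refine ContDiff.contDiffOn (contDiff_succ_iff_deriv (n := 1).2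
      ⟨fun x => (hd x).differentiableAt, by simp, ?_⟩)
    rw [show deriv _ = arctanSeries c from funext fun x => (hd x).deriv]
    exact contDiff_arctanSeries hc hs
  nonneg x hx := intervalIntegral.integral_nonneg hx fun t ht =>
    arctanSeries_zero.ge.trans (monotone_arctanSeries hc hs ht.1)
  convex := by
    have hd := hasDerivAt_primitive (contDiff_arctanSeries hc hs).continuous
    refine MonotoneOn.convexOn_of_deriv (convex_Ici 0)
      (fun x _ => (hd x).continuousAt.continuousWithinAt)
      (fun x _ => (hd x).differentiableAt.differentiableWithinAt) ?_
    rw [show deriv _ = arctanSeries c from funext fun x => (hd x).deriv]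
    exact (monotone_arctanSeries hc hs).monotoneOn _
  zero := intervalIntegral.integral_same
  deriv_zero := arctanSeries_zero
  concave_deriv := concaveOn_arctanSeries hc hs
  deriv_pos _ hx := arctanSeries_pos hc hs hx
  tendsto_deriv := tendsto_arctanSeries hc hs
  tendsto_div := by
    have hlim : Tendsto (fun x : ℝ => arctanSeries c (x / 2) / 2) atTop atTop :=
      ((tendsto_arctanSeries hc hs).comp (tendsto_id.atTop_div_const two_pos)).atTop_div_const
        two_pos
    refine tendsto_atTop_mono' _ ?_ hlim
    filter_upwards [eventually_gt_atTop 0] with x hx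
    rw [le_div_iff₀ hx]
    have := mul_half_le_primitive (contDiff_arctanSeries hc hs).continuous
      (monotone_arctanSeries hc hs) arctanSeries_zero.ge hx.le
    linarith

theorem abs_arctan_le_pi_div_two (x : ℝ) : |Real.arctan x| ≤ Real.pi / 2 :=
  abs_le.2 ⟨(Real.neg_pi_div_two_lt_arctan x).le, (Real.arctan_lt_pi_div_two x).le⟩

theorem summable_mul_arctan {a : ℕ → ℝ} (ha : ∀ j, 0 ≤ a j) (hs : Summable a) (s : ℝ) :
    Summable fun j : ℕ => a j * Real.arctan (s * j) := by
  refine .of_norm_bounded (hs.mul_right (Real.pi / 2)) fun j => ?_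
  rw [norm_mul, Real.norm_of_nonneg (ha j)]
  exact mul_le_mul_of_nonneg_left (abs_arctan_le_pi_div_two _) (ha j)

theorem tendsto_tsum_mul_arctan {a : ℕ → ℝ} (ha : ∀ j, 0 ≤ a j) (hs : Summable a) :
    Tendsto (fun s : ℝ => ∑' j : ℕ, a j * Real.arctan (s * j)) (𝓝 0) (𝓝 0) := by
  have h := tendsto_tsum_of_dominated_convergence (𝓕 := 𝓝 (0 : ℝ))
    (f := fun s j => a j * Real.arctan (s * (j : ℕ))) (g := fun _ => (0 : ℝ))
    (bound := fun j => a j * (Real.pi / 2)) (hs.mul_right _) (fun j => ?_)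
    (Eventually.of_forall fun s j => ?_)
  · simpa using h
  · have : Continuous fun s : ℝ => a j * Real.arctan (s * j) := by fun_prop
    simpa using this.tendsto 0
  · rw [norm_mul, Real.norm_of_nonneg (ha j)]
    exact mul_le_mul_of_nonneg_left (abs_arctan_le_pi_div_two _) (ha j)

theorem exists_summable_mul_arctanSeries {a : ℕ → ℝ} (ha : ∀ j, 0 ≤ a j) (hs : Summable a) :
    ∃ c : ℕ → ℝ, (∀ k, 0 < c k) ∧ Summable c ∧ Summable fun j : ℕ => a j * arctanSeries c j := by
  have hex : ∀ k : ℕ, ∃ s : ℝ, 0 < s ∧ s < (1 / 2) ^ k ∧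
      ∑' j : ℕ, a j * Real.arctan (s * j) < (1 / 2) ^ k := fun k => by
    have hk : (0 : ℝ) < (1 / 2) ^ k := by positivity
    have h0 : Tendsto id (𝓝[>] (0 : ℝ)) (𝓝 0) := nhdsWithin_le_nhds
    have h1 := h0.eventually_lt_const hk
    have h2 := ((tendsto_tsum_mul_arctan ha hs).comp h0).eventually_lt_const hk
    exact (eventually_mem_nhdsWithin.and (h1.and h2)).exists
  choose c hc hlt htsum using hex
  refine ⟨c, hc, .of_nonneg_of_le (fun k => (hc k).le) (fun k => (hlt k).le)
    summable_geometric_two, ?_⟩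
  have hnn : ∀ k j : ℕ, 0 ≤ a j * Real.arctan (c k * j) := fun k j =>
    mul_nonneg (ha j) (Real.arctan_nonneg.2 (mul_nonneg (hc k).le j.cast_nonneg))
  have hprod : Summable fun p : ℕ × ℕ => a p.2 * Real.arctan (c p.1 * p.2) :=
    (summable_prod_of_nonneg fun p => hnn p.1 p.2).2
      ⟨fun k => summable_mul_arctan ha hs (c k), .of_nonneg_of_le (fun k => tsum_nonneg (hnn k))
        (fun k => (htsum k).le) summable_geometric_two⟩
  simpa [arctanSeries, tsum_mul_left] using hprod.prod_symm.prod

/-- Lemma 3.3, de la Vallée-Poussin: existence of `G ∈ 𝒢_{1,∞}` with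
`∑ j^{λ−1} G(j) f_j(0) < ∞`; the case `λ = 1` gives `∑ G(j) f_j(0) < ∞`. -/
theorem de_la_vallee_poussin (lam : ℝ) (hlam : 1 ≤ lam) (f0 : ℕ → ℝ)
    (hf0 : ∀ j : ℕ, 0 ≤ f0 j) (hsum : Summable (fun j : ℕ => (j : ℝ) ^ lam * f0 j)) :
    ∃ 𝒢 : G1Inf, Summable (fun j : ℕ => (j : ℝ) ^ (lam - 1) * 𝒢.G j * f0 j) := by
  obtain ⟨c, hc, hs, hac⟩ := exists_summable_mul_arctanSeries
    (fun j => mul_nonneg (Real.rpow_nonneg j.cast_nonneg lam) (hf0 j)) hsum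
  let 𝒢 := G1Inf.ofArctanSeries c hc hs
  refine ⟨𝒢, .of_nonneg_of_le (fun j => mul_nonneg (mul_nonneg
    (Real.rpow_nonneg j.cast_nonneg _) (𝒢.nonneg j (mem_Ici.2 j.cast_nonneg))) (hf0 j)) (fun j => ?_) hac⟩
  have hG : 𝒢.G j ≤ j * arctanSeries c j := primitive_le_mul
    (contDiff_arctanSeries hc hs).continuous (monotone_arctanSeries hc hs) j.cast_nonneg
  have hpow : (j : ℝ) ^ (lam - 1) * j = (j : ℝ) ^ lam := by
    rw [← Real.rpow_add_one' j.cast_nonneg (by linarith), sub_add_cancel]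
  calc (j : ℝ) ^ (lam - 1) * 𝒢.G j * f0 j
      ≤ (j : ℝ) ^ (lam - 1) * (j * arctanSeries c j) * f0 j := by
        have := hf0 j
        gcongr
    _ = (j : ℝ) ^ lam * f0 j * arctanSeries c j := by rw [← hpow]; ring
end

section
/- Let G ∈ 𝒢_{1,∞}. Then: (i) for every λ ∈ (1,2] and every x ≥ 2, (x+1)^{λ−1} G(x+1) − 2 x^{λ−1} G(x) + (x−1)^{λ−1} G(x−1) ≤ (4λ − 2) G′(x+1); and (ii) for every x ≥ 1, G(x+1) − 2 G(x) + G(x−1) ≤ G′(x+1). -/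
open MeasureTheory Filter

namespace G1Inf

variable (𝒢 : G1Inf)

lemma hasDerivAt {x : ℝ} (hx : 0 < x) : HasDerivAt 𝒢.G (𝒢.G' x) x :=
  (𝒢.hasDeriv x hx.le).hasDerivAt (Ici_mem_nhds hx)

lemma continuousOn : ContinuousOn 𝒢.G (Set.Ici 0) := fun x hx =>
  (𝒢.hasDeriv x hx).continuousWithinAt

lemma deriv_mono {x y : ℝ} (hx : 0 < x) (hxy : x ≤ y) : 𝒢.G' x ≤ 𝒢.G' y := by
  rcases hxy.eq_or_lt with rfl | h
  · exact le_rfl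
  have hy : 0 < y := hx.trans h
  exact (𝒢.convex.le_slope_of_hasDerivAt hx.le hy.le h (𝒢.hasDerivAt hx)).trans
    (𝒢.convex.slope_le_of_hasDerivAt hx.le hy.le h (𝒢.hasDerivAt hy))

lemma sub_le_mul_deriv {x y : ℝ} (hx : 0 < x) (h : x < y) :
    𝒢.G y - 𝒢.G x ≤ (y - x) * 𝒢.G' y := by
  have hy : 0 < y := hx.trans h
  have := 𝒢.convex.slope_le_of_hasDerivAt hx.le hy.le h (𝒢.hasDerivAt hy)
  rw [slope_def_field, div_le_iff₀ (sub_pos.2 h)] at this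
  linarith

lemma mul_deriv_le {x y : ℝ} (hx : 0 < x) (h : x ≤ y) : x * 𝒢.G' y ≤ y * 𝒢.G' x := by
  have hy : 0 < y := hx.trans_le h
  have := 𝒢.concave_deriv.2 (Set.mem_Ici.2 hy.le) (Set.self_mem_Ici (a := (0 : ℝ)))
    (show 0 ≤ x / y by positivity)
    (show 0 ≤ 1 - x / y from sub_nonneg.2 ((div_le_one hy).2 h)) (by ring)
  simp only [smul_eq_mul, 𝒢.deriv_zero, mul_zero, add_zero, div_mul_cancel₀ x hy.ne'] at this
  rw [div_mul_eq_mul_div, div_le_iff₀ hy] at this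
  linarith

end G1Inf

/-- Mean value form of the second difference with unit step. -/
lemma exists_second_difference_eq {F F' : ℝ → ℝ} (hc : ContinuousOn F (Set.Ici 0))
    (hF : ∀ x, 0 < x → HasDerivAt F (F' x) x) {x : ℝ} (hx : 1 ≤ x) :
    ∃ y ∈ Set.Ioo x (x + 1), F (x + 1) - 2 * F x + F (x - 1) = F' y - F' (y - 1) := by
  obtain ⟨y, hy, h⟩ := exists_hasDerivAt_eq_slope (fun t => F t - F (t - 1))
    (fun t => F' t - F' (t - 1)) (lt_add_one x)
    ((hc.mono fun t ht => Set.mem_Ici.2 (by linarith [ht.1])).sub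
      (hc.comp (by fun_prop) fun t ht => Set.mem_Ici.2 (by linarith [ht.1])))
    (fun t ht => (hF t (by linarith [ht.1])).sub
      ((hF (t - 1) (by linarith [ht.1])).comp_sub_const t 1))
  refine ⟨y, hy, ?_⟩
  simp only [add_sub_cancel_left, div_one, add_sub_cancel_right] at h
  linarith

/-- Bound for the increment of the derivative of `x ↦ x ^ m * G x` over a unit step. -/
lemma G1Inf.weighted_deriv_sub_le (𝒢 : G1Inf) {m y : ℝ} (hm0 : 0 < m) (hm1 : m ≤ 1)
    (hy : 1 < y) :
    (m * y ^ (m - 1) * 𝒢.G y + y ^ m * 𝒢.G' y)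
      - (m * (y - 1) ^ (m - 1) * 𝒢.G (y - 1) + (y - 1) ^ m * 𝒢.G' (y - 1))
      ≤ (m + 2) * 𝒢.G' y := by
  have hz : 0 < y - 1 := sub_pos.2 hy
  have hy0 : 0 < y := by linarith
  have ey : y ^ m = y ^ (m - 1) * y := by rw [← Real.rpow_add_one hy0.ne', sub_add_cancel]
  have ez : (y - 1) ^ m = (y - 1) ^ (m - 1) * (y - 1) := by
    rw [← Real.rpow_add_one hz.ne', sub_add_cancel]
  have hq : y ^ (m - 1) ≤ (y - 1) ^ (m - 1) :=
    Real.rpow_le_rpow_of_nonpos hz (by linarith) (by linarith)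
  have hp1 : y ^ (m - 1) ≤ 1 := Real.rpow_le_one_of_one_le_of_nonpos hy.le (by linarith)
  have hp0 : 0 < y ^ (m - 1) := Real.rpow_pos_of_pos hy0 _
  have hG := 𝒢.sub_le_mul_deriv hz (sub_one_lt y)
  have hg := 𝒢.mul_deriv_le hz (sub_one_lt y).le
  have hmono := 𝒢.deriv_mono hz (sub_one_lt y).le
  have hGz := 𝒢.nonneg (y - 1) hz.le
  have hgz := 𝒢.deriv_pos (y - 1) hz
  have hgy := 𝒢.deriv_pos y hy0
  rw [ey, ez]
  set p := y ^ (m - 1)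
  set q := (y - 1) ^ (m - 1)
  have hA : 0 ≤ m * 𝒢.G (y - 1) + (y - 1) * 𝒢.G' (y - 1) := by positivity
  have hB : m * (𝒢.G y - 𝒢.G (y - 1)) + (y * 𝒢.G' y - (y - 1) * 𝒢.G' (y - 1))
      ≤ (m + 2) * 𝒢.G' y := by
    have := mul_le_mul_of_nonneg_left hG hm0.le
    linarith
  have hC := mul_le_mul_of_nonneg_left hB hp0.le
  have hD := mul_le_mul_of_nonneg_right hq hA
  have hE : p * ((m + 2) * 𝒢.G' y) ≤ (m + 2) * 𝒢.G' y :=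
    mul_le_of_le_one_left (by positivity) hp1
  linarith

/-- Lemma 3.4, inequalities (3.14) and (3.15) for `G ∈ 𝒢_{1,∞}`. -/
theorem g1inf_second_difference_bounds (𝒢 : G1Inf) :
    (∀ lam : ℝ, lam ∈ Set.Ioc (1:ℝ) 2 → ∀ x : ℝ, 2 ≤ x →
      (x + 1) ^ (lam - 1) * 𝒢.G (x + 1) - 2 * x ^ (lam - 1) * 𝒢.G x
          + (x - 1) ^ (lam - 1) * 𝒢.G (x - 1) ≤ (4 * lam - 2) * 𝒢.G' (x + 1)) ∧
    (∀ x : ℝ, 1 ≤ x → 𝒢.G (x + 1) - 2 * 𝒢.G x + 𝒢.G (x - 1) ≤ 𝒢.G' (x + 1)) := by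
  refine ⟨fun lam hlam x hx => ?_, fun x hx => ?_⟩
  · have h1 : 0 < lam - 1 := sub_pos.2 hlam.1
    obtain ⟨y, hy, h⟩ := exists_second_difference_eq
      (F := fun t => t ^ (lam - 1) * 𝒢.G t)
      ((Real.continuous_rpow_const h1.le).continuousOn.mul 𝒢.continuousOn)
      (fun t ht => (Real.hasDerivAt_rpow_const (Or.inl ht.ne')).mul (𝒢.hasDerivAt ht))
      (one_le_two.trans hx)
    have hb := 𝒢.weighted_deriv_sub_le h1 (by linarith [hlam.2])
      (show 1 < y by linarith [hy.1])
    have hmono := 𝒢.deriv_mono (show 0 < y by linarith [hy.1]) hy.2.le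
    have hpos := 𝒢.deriv_pos (x + 1) (by linarith)
    have h2 := mul_le_mul_of_nonneg_left hmono (show 0 ≤ lam - 1 + 2 by linarith)
    have h3 := mul_le_mul_of_nonneg_right (show lam - 1 + 2 ≤ 4 * lam - 2 by linarith [hlam.1])
      hpos.le
    linarith
  · obtain ⟨y, hy, h⟩ := exists_second_difference_eq 𝒢.continuousOn
      (fun t => 𝒢.hasDerivAt) hx
    have hmono := 𝒢.deriv_mono (show 0 < y by linarith [hy.1]) hy.2.le
    have hpos := 𝒢.deriv_pos (y - 1) (by linarith [hy.1])
    linarith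
end

section
/- Let 1 < α ≤ 2 and let K : ℕ₀×ℕ₀ → [0,∞) be a symmetric kernel satisfying C_1 (j² k^α + j^α k²) ≤ K_{j,k} ≤ C j² k² for all j,k ∈ ℕ₀, with C, C_1 > 0 (so in particular K_{j,0} = 0 = K_{0,k}). Let r ≥ 2, let f(0) = (f_j(0))_{j≥0} ∈ Y_r^+ with M_r(f(0)) > 0, let 0 < T_0 < (2 M_2(f(0)) C)^{−1}, and let f be a mild solution of the EDG system on [0,T_0] with values in Y_2^+ satisfying M_2(f(t)) ≤ [1/M_2(f(0)) − 2Ct]^{−1} for t ∈ [0,T_0]. Then f(t) ∈ Y_r^+ for all t ∈ [0,T_0]; more precisely, M_r(f(t)) ≤ M_r(f(0)) e^{C⋆ t} where C⋆ = C r(r−1) 2^{r−2} M_2(f(0)) / (1 − 2C T_0 M_2(f(0))). -/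
open MeasureTheory Filter

theorem rpow_sub_rpow_le_mul_sub {p a b : ℝ} (hp : 1 ≤ p) (ha : 0 < a) (hb : 0 ≤ b) :
    a ^ p - b ^ p ≤ p * a ^ (p - 1) * (a - b) := by
  have h := one_add_mul_self_le_rpow_one_add (s := b / a - 1) (by
    have : 0 ≤ b / a := by positivity
    linarith) hp
  have h2 : (1 + (b / a - 1)) ^ p = b ^ p / a ^ p := by
    rw [add_sub_cancel, Real.div_rpow hb ha.le]
  have hap : 0 < a ^ p := Real.rpow_pos_of_pos ha p
  rw [h2, le_div_iff₀ hap] at h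
  have h3 : a ^ p = a ^ (p - 1) * a := by
    rw [← Real.rpow_add_one ha.ne', sub_add_cancel]
  have h4 : (1 + p * (b / a - 1)) * a ^ p = a ^ p - p * a ^ (p - 1) * (a - b) := by
    rw [h3]
    field_simp
    ring
  linarith

theorem second_difference_rpow_le {r x : ℝ} (hr : 2 ≤ r) (hx : 1 ≤ x) :
    (x + 1) ^ r - 2 * x ^ r + (x - 1) ^ r ≤ r * (r - 1) * 2 ^ (r - 2) * x ^ (r - 2) := by
  set D : ℝ := r * (r - 1) * (2 * x) ^ (r - 2) with hD
  let h : ℝ → ℝ := fun s => (x + s) ^ r + (x - s) ^ r - D * s ^ 2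
  have hderiv : ∀ s : ℝ, HasDerivAt h
      (r * (x + s) ^ (r - 1) - r * (x - s) ^ (r - 1) - D * (2 * s)) s := by
    intro s
    have h1 := ((hasDerivAt_id s).const_add x).rpow_const (p := r) (Or.inr (by linarith))
    have h2 := ((hasDerivAt_id s).const_sub x).rpow_const (p := r) (Or.inr (by linarith))
    have h3 := ((hasDerivAt_id s).pow 2).const_mul D
    refine ((h1.add h2).sub h3).congr_deriv ?_
    simp only [id]
    ring
  have hanti : AntitoneOn h (Set.Icc 0 1) := by
    refine antitoneOn_of_deriv_nonpos (convex_Icc 0 1)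
      (fun s _ => (hderiv s).continuousAt.continuousWithinAt)
      (fun s _ => (hderiv s).differentiableAt.differentiableWithinAt) ?_
    intro s hs
    rw [interior_Icc] at hs
    obtain ⟨hs0, hs1⟩ := hs
    rw [(hderiv s).deriv]
    have h1 := rpow_sub_rpow_le_mul_sub (p := r - 1) (a := x + s) (b := x - s)
      (by linarith) (by linarith) (by linarith)
    have h2 : (x + s) ^ (r - 1 - 1) ≤ (2 * x) ^ (r - 2) := by
      rw [show r - 1 - 1 = r - 2 by ring]
      exact Real.rpow_le_rpow (by linarith) (by linarith) (by linarith)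
    have h3 : r * ((r - 1) * (x + s) ^ (r - 1 - 1) * (x + s - (x - s))) ≤ D * (2 * s) := by
      have : D * (2 * s) = r * (r - 1) * (2 * s) * (2 * x) ^ (r - 2) := by rw [hD]; ring
      rw [this]
      have h4 : 0 ≤ r * (r - 1) * (2 * s) :=
        mul_nonneg (mul_nonneg (by linarith) (by linarith)) (by linarith)
      have := mul_le_mul_of_nonneg_left h2 h4
      linarith
    have := mul_le_mul_of_nonneg_left h1 (show 0 ≤ r by linarith)
    linarith
  have h01 := hanti (by simp) (by simp) (zero_le_one' ℝ)
  have hDx : D = r * (r - 1) * 2 ^ (r - 2) * x ^ (r - 2) := by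
    rw [hD, Real.mul_rpow (by norm_num) (by linarith)]
    ring
  simp only [h] at h01
  rw [← hDx]
  simp only [add_zero, sub_zero] at h01
  linarith

theorem sum_mul_second_difference (φ b : ℕ → ℝ) (hφ : φ 0 = 0) (hb : b 0 = 0) (M : ℕ) :
    ∑ m ∈ Finset.range (M + 1), φ (m + 1) * (b (m + 2) - b (m + 1) - b (m + 1) + b m) =
      ∑ m ∈ Finset.range (M + 1), (φ (m + 2) - 2 * φ (m + 1) + φ m) * b (m + 1) +
        (φ (M + 1) * b (M + 2) - φ (M + 2) * b (M + 1)) := by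
  induction M with
  | zero => simp [hφ, hb]; ring
  | succ M ih =>
    rw [Finset.sum_range_succ, ih, Finset.sum_range_succ _ (M + 1)]
    ring

/-- The power weight `j ^ r`, truncated at height `L`. -/
noncomputable def truncatedPower (r L : ℝ) (j : ℕ) : ℝ := min ((j : ℝ) ^ r) L

theorem truncatedPower_nonneg {r L : ℝ} (hL : 0 ≤ L) (j : ℕ) : 0 ≤ truncatedPower r L j :=
  le_min (by positivity) hL

theorem second_difference_truncatedPower_mul_le {r L A b g : ℝ} (hr : 2 ≤ r) (hL : 0 ≤ L)
    (hA : 0 ≤ A) (m : ℕ) (hb : 0 ≤ b) (hg : 0 ≤ g)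
    (hbg : b ≤ A * ((m + 1 : ℕ) : ℝ) ^ 2 * g) :
    (truncatedPower r L (m + 2) - 2 * truncatedPower r L (m + 1) + truncatedPower r L m) * b ≤
      r * (r - 1) * 2 ^ (r - 2) * A * (truncatedPower r L (m + 1) * g) := by
  have hc : 0 ≤ r * (r - 1) * 2 ^ (r - 2) :=
    mul_nonneg (mul_nonneg (by linarith) (by linarith)) (by positivity)
  have hx : (1 : ℝ) ≤ ((m + 1 : ℕ) : ℝ) := by exact_mod_cast Nat.succ_le_succ m.zero_le
  by_cases h : ((m + 1 : ℕ) : ℝ) ^ r ≤ L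
  · have h1 : truncatedPower r L (m + 1) = ((m + 1 : ℕ) : ℝ) ^ r := min_eq_left h
    have h2 : truncatedPower r L (m + 2) ≤ (((m + 1 : ℕ) : ℝ) + 1) ^ r := by
      refine (min_le_left _ _).trans_eq ?_
      push_cast
      ring_nf
    have h3 : truncatedPower r L m ≤ (((m + 1 : ℕ) : ℝ) - 1) ^ r := by
      refine (min_le_left _ _).trans_eq ?_
      push_cast
      ring_nf
    have h4 := second_difference_rpow_le hr hx
    set x : ℝ := ((m + 1 : ℕ) : ℝ)
    have h5 : x ^ r = x ^ (r - 2) * x ^ 2 := by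
      rw [← Real.rpow_natCast x 2, ← Real.rpow_add (by linarith)]
      norm_num
    rw [h1]
    calc _ ≤ (r * (r - 1) * 2 ^ (r - 2) * x ^ (r - 2)) * b :=
          mul_le_mul_of_nonneg_right (by linarith) hb
      _ ≤ (r * (r - 1) * 2 ^ (r - 2) * x ^ (r - 2)) * (A * x ^ 2 * g) :=
          mul_le_mul_of_nonneg_left hbg (mul_nonneg hc (by positivity))
      _ = _ := by rw [h5]; ring
  · have h1 : truncatedPower r L (m + 1) = L := min_eq_right (not_le.mp h).le
    have h2 : truncatedPower r L (m + 2) ≤ L := min_le_right _ _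
    have h3 : truncatedPower r L m ≤ L := min_le_right _ _
    refine (mul_nonpos_of_nonpos_of_nonneg (by linarith) hb).trans ?_
    have := truncatedPower_nonneg (r := r) hL (m + 1)
    positivity

/-- Grönwall's inequality in integral form. -/
theorem le_mul_exp_of_le_add_mul_integral {u : ℝ → ℝ} {T δ k : ℝ} (hk : 0 ≤ k)
    (hu : ContinuousOn u (Set.Icc 0 T))
    (h : ∀ t ∈ Set.Icc 0 T, u t ≤ δ + k * ∫ s in (0 : ℝ)..t, u s) :
    ∀ t ∈ Set.Icc 0 T, u t ≤ δ * Real.exp (k * t) := by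
  intro t ht
  have hT : 0 ≤ T := ht.1.trans ht.2
  let w : ℝ → ℝ := fun t => Real.exp (-(k * t)) * (δ + k * ∫ s in (0 : ℝ)..t, u s)
  have hder : ∀ x ∈ Set.Ioo 0 T, HasDerivAt w
      (Real.exp (-(k * x)) * (k * (u x - (δ + k * ∫ s in (0 : ℝ)..x, u s)))) x := by
    intro x hx
    have hint : IntervalIntegrable u volume 0 x :=
      (hu.mono (by rw [Set.uIcc_of_le hx.1.le]; exact Set.Icc_subset_Icc_right hx.2.le)
        ).intervalIntegrable
    have h1 : HasDerivAt (fun t => ∫ s in (0 : ℝ)..t, u s) (u x) x :=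
      intervalIntegral.integral_hasDerivAt_right hint
        ((hu.mono Set.Ioo_subset_Icc_self).stronglyMeasurableAtFilter isOpen_Ioo x hx)
        (hu.continuousAt (Icc_mem_nhds hx.1 hx.2))
    have h2 := (((hasDerivAt_id x).const_mul k).neg).exp
    refine (h2.mul ((h1.const_mul k).const_add δ)).congr_deriv ?_
    simp only [id, Pi.neg_apply]
    ring
  have hcont : ContinuousOn w (Set.Icc 0 T) := by
    have hprim : ContinuousOn (fun t => ∫ s in (0 : ℝ)..t, u s) (Set.Icc 0 T) := by
      have := intervalIntegral.continuousOn_primitive_interval (a := 0) (b := T) (f := u)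
        (μ := volume) (by rw [Set.uIcc_of_le hT]; exact hu.integrableOn_Icc)
      rwa [Set.uIcc_of_le hT] at this
    exact (by fun_prop : ContinuousOn (fun t : ℝ => Real.exp (-(k * t))) _).mul
      (continuousOn_const.add (continuousOn_const.mul hprim))
  have hanti : AntitoneOn w (Set.Icc 0 T) := by
    refine antitoneOn_of_deriv_nonpos (convex_Icc 0 T) hcont ?_ ?_ <;> rw [interior_Icc]
    · exact fun x hx => (hder x hx).differentiableAt.differentiableWithinAt
    · intro x hx
      rw [(hder x hx).deriv]
      have := h x ⟨hx.1.le, hx.2.le⟩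
      exact mul_nonpos_of_nonneg_of_nonpos (Real.exp_pos _).le
        (mul_nonpos_of_nonneg_of_nonpos hk (by linarith))
  have hw := hanti ⟨le_rfl, hT⟩ ht ht.1
  simp only [w, mul_zero, neg_zero, Real.exp_zero, intervalIntegral.integral_same, add_zero,
    one_mul] at hw
  rw [Real.exp_neg, inv_mul_le_iff₀ (Real.exp_pos _)] at hw
  linarith [h t ht]

/-- If the fluxes `b j` are dominated by `A j ^ 2 f j` then their time integrals
vanish as `j → ∞`. -/
theorem tendsto_integral_flux {T A B : ℝ} {f b : ℝ → ℕ → ℝ} (hT : 0 ≤ T) (hA : 0 ≤ A)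
    (hint : ∀ j, IntervalIntegrable (fun s => b s j) volume 0 T)
    (hb : ∀ s ∈ Set.Icc 0 T, ∀ j, 0 ≤ b s j)
    (hbf : ∀ s ∈ Set.Icc 0 T, ∀ j, b s j ≤ A * (j : ℝ) ^ 2 * f s j)
    (hB : ∀ s ∈ Set.Icc 0 T, ∀ n, ∑ j ∈ Finset.range n, (j : ℝ) ^ 2 * f s j ≤ B) :
    Tendsto (fun j => ∫ s in (0 : ℝ)..T, b s j) atTop (nhds 0) := by
  refine (summable_of_sum_range_le (c := T * (A * B))
    (fun j => intervalIntegral.integral_nonneg hT fun s hs => hb s hs j)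
    fun n => ?_).tendsto_atTop_zero
  rw [← intervalIntegral.integral_finsetSum fun j _ => hint j]
  have h := intervalIntegral.integral_mono_on hT
    (f := fun s => ∑ j ∈ Finset.range n, b s j) (g := fun _ => A * B)
    (μ := volume)
    (by simpa only [Finset.sum_fn] using IntervalIntegrable.sum _ fun j _ => hint j)
    intervalIntegrable_const fun s hs => by
      calc ∑ j ∈ Finset.range n, b s j
          ≤ ∑ j ∈ Finset.range n, A * ((j : ℝ) ^ 2 * f s j) :=
            Finset.sum_le_sum fun j _ => (hbf s hs j).trans_eq (mul_assoc _ _ _)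
        _ = A * ∑ j ∈ Finset.range n, (j : ℝ) ^ 2 * f s j := (Finset.mul_sum _ _ _).symm
        _ ≤ A * B := mul_le_mul_of_nonneg_left (hB s hs n) hA
  rwa [intervalIntegral.integral_const, sub_zero, smul_eq_mul] at h

theorem sum_truncatedPower_le {r L T A m : ℝ} {f b : ℝ → ℕ → ℝ} (hr : 2 ≤ r) (hL : 0 ≤ L)
    (hT : 0 ≤ T) (hA : 0 ≤ A)
    (hf : ∀ s ∈ Set.Icc 0 T, ∀ j, 0 ≤ f s j)
    (hfc : ∀ j, ContinuousOn (fun s => f s j) (Set.Icc 0 T))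
    (hint : ∀ j, IntervalIntegrable (fun s => b s j) volume 0 T)
    (hb : ∀ s ∈ Set.Icc 0 T, ∀ j, 0 ≤ b s j)
    (hbf : ∀ s ∈ Set.Icc 0 T, ∀ j, b s j ≤ A * (j : ℝ) ^ 2 * f s j)
    (hevol : ∀ t ∈ Set.Icc 0 T, ∀ j, f t (j + 1) = f 0 (j + 1) +
      ∫ s in (0 : ℝ)..t, (b s (j + 2) - b s (j + 1) - b s (j + 1) + b s j))
    (hm : ∀ n, ∑ j ∈ Finset.range n, (j : ℝ) ^ r * f 0 j ≤ m)
    (M : ℕ) (hM : L ≤ ((M + 1 : ℕ) : ℝ) ^ r) {t : ℝ} (ht : t ∈ Set.Icc 0 T) :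
    ∑ j ∈ Finset.range (M + 1), truncatedPower r L (j + 1) * f t (j + 1) ≤
      (m + L * ∫ s in (0 : ℝ)..T, b s (M + 2)) *
        Real.exp (r * (r - 1) * 2 ^ (r - 2) * A * t) := by
  have hk : 0 ≤ r * (r - 1) * 2 ^ (r - 2) * A :=
    mul_nonneg (mul_nonneg (mul_nonneg (by linarith) (by linarith)) (by positivity)) hA
  set k := r * (r - 1) * 2 ^ (r - 2) * A
  set φ := truncatedPower r L with hφ
  have hφ0 : φ 0 = 0 := by
    simp [hφ, truncatedPower, Real.zero_rpow (show r ≠ 0 by linarith), hL]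
  have hφ1 : φ (M + 1) = L := min_eq_right hM
  have hφ2 : φ (M + 2) = L := min_eq_right (hM.trans
    (Real.rpow_le_rpow (by positivity) (by push_cast; linarith) (by linarith)))
  have hφn : ∀ j, 0 ≤ φ j := truncatedPower_nonneg hL
  have huc : ContinuousOn (fun s => ∑ j ∈ Finset.range (M + 1), φ (j + 1) * f s (j + 1))
      (Set.Icc 0 T) :=
    continuousOn_finsetSum _ fun j _ => continuousOn_const.mul (hfc (j + 1))
  refine le_mul_exp_of_le_add_mul_integral hk huc (fun t ht => ?_) t ht
  have hsub : Set.uIcc 0 t ⊆ Set.uIcc 0 T := by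
    rw [Set.uIcc_of_le ht.1, Set.uIcc_of_le hT]
    exact Set.Icc_subset_Icc_right ht.2
  have hint' : ∀ j, IntervalIntegrable (fun s => b s j) volume 0 t :=
    fun j => (hint j).mono_set hsub
  have hIE : ∀ j, IntervalIntegrable
      (fun s => b s (j + 2) - b s (j + 1) - b s (j + 1) + b s j) volume 0 t :=
    fun j => (((hint' _).sub (hint' _)).sub (hint' _)).add (hint' _)
  have huI : IntervalIntegrable (fun s => ∑ j ∈ Finset.range (M + 1), φ (j + 1) * f s (j + 1))
      volume 0 t :=
    (huc.mono (by rw [Set.uIcc_of_le ht.1]; exact Set.Icc_subset_Icc_right ht.2)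
      ).intervalIntegrable
  have hid : ∑ j ∈ Finset.range (M + 1), φ (j + 1) * f t (j + 1) =
      ∑ j ∈ Finset.range (M + 1), φ (j + 1) * f 0 (j + 1) + ∫ s in (0 : ℝ)..t,
        ∑ j ∈ Finset.range (M + 1),
          φ (j + 1) * (b s (j + 2) - b s (j + 1) - b s (j + 1) + b s j) := by
    rw [intervalIntegral.integral_finsetSum fun j _ => (hIE j).const_mul _,
      ← Finset.sum_add_distrib]
    refine Finset.sum_congr rfl fun j _ => ?_
    rw [intervalIntegral.integral_const_mul, hevol t ht j]
    ring
  have hinit : ∑ j ∈ Finset.range (M + 1), φ (j + 1) * f 0 (j + 1) ≤ m := by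
    refine le_trans ?_ (hm (M + 2))
    have h0 := hf 0 ⟨le_rfl, hT⟩
    rw [Finset.sum_range_succ' _ (M + 1)]
    refine le_add_of_le_of_nonneg (Finset.sum_le_sum fun j _ => ?_)
      (mul_nonneg (by positivity) (h0 0))
    exact mul_le_mul_of_nonneg_right (min_le_left _ _) (h0 _)
  have hmono : (∫ s in (0 : ℝ)..t, ∑ j ∈ Finset.range (M + 1),
        φ (j + 1) * (b s (j + 2) - b s (j + 1) - b s (j + 1) + b s j)) ≤
      ∫ s in (0 : ℝ)..t, (k * ∑ j ∈ Finset.range (M + 1), φ (j + 1) * f s (j + 1)) +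
        L * b s (M + 2) := by
    refine intervalIntegral.integral_mono_on ht.1 ?_
      ((huI.const_mul k).add ((hint' _).const_mul L)) fun s hs => ?_
    · simpa only [Finset.sum_fn] using
        IntervalIntegrable.sum (Finset.range (M + 1)) fun j _ => (hIE j).const_mul (φ (j + 1))
    have hs' : s ∈ Set.Icc 0 T := ⟨hs.1, hs.2.trans ht.2⟩
    have hb0 : b s 0 = 0 := le_antisymm (by simpa using hbf s hs' 0) (hb s hs' 0)
    rw [sum_mul_second_difference φ (b s) hφ0 hb0, hφ1, hφ2, Finset.mul_sum]
    refine add_le_add (Finset.sum_le_sum fun j _ => ?_) ?_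
    · exact second_difference_truncatedPower_mul_le hr hL hA j (hb s hs' _) (hf s hs' _)
        (hbf s hs' _)
    · linarith [mul_nonneg hL (hb s hs' (M + 1))]
  rw [intervalIntegral.integral_add (huI.const_mul k) ((hint' _).const_mul L),
    intervalIntegral.integral_const_mul, intervalIntegral.integral_const_mul] at hmono
  have hflux : (∫ s in (0 : ℝ)..t, b s (M + 2)) ≤ ∫ s in (0 : ℝ)..T, b s (M + 2) := by
    refine intervalIntegral.integral_mono_interval le_rfl ht.1 ht.2 ?_ (hint _)
    refine ae_restrict_of_forall_mem measurableSet_Ioc fun s hs => ?_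
    exact hb s (Set.Ioc_subset_Icc_self hs) _
  have := mul_le_mul_of_nonneg_left hflux hL
  rw [hid]
  linarith

/-- Propagation of the `r`-th moment for a discrete diffusion `∂ₜ f = Δ b` with flux
`b j ≤ A j ^ 2 f j`, stated for partial sums. -/
theorem sum_rpow_mul_le {r T A B m : ℝ} {f b : ℝ → ℕ → ℝ} (hr : 2 ≤ r)
    (hT : 0 ≤ T) (hA : 0 ≤ A)
    (hf : ∀ s ∈ Set.Icc 0 T, ∀ j, 0 ≤ f s j)
    (hfc : ∀ j, ContinuousOn (fun s => f s j) (Set.Icc 0 T))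
    (hint : ∀ j, IntervalIntegrable (fun s => b s j) volume 0 T)
    (hb : ∀ s ∈ Set.Icc 0 T, ∀ j, 0 ≤ b s j)
    (hbf : ∀ s ∈ Set.Icc 0 T, ∀ j, b s j ≤ A * (j : ℝ) ^ 2 * f s j)
    (hB : ∀ s ∈ Set.Icc 0 T, ∀ n, ∑ j ∈ Finset.range n, (j : ℝ) ^ 2 * f s j ≤ B)
    (hevol : ∀ t ∈ Set.Icc 0 T, ∀ j, f t (j + 1) = f 0 (j + 1) +
      ∫ s in (0 : ℝ)..t, (b s (j + 2) - b s (j + 1) - b s (j + 1) + b s j))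
    (hm : ∀ n, ∑ j ∈ Finset.range n, (j : ℝ) ^ r * f 0 j ≤ m)
    (n : ℕ) {t : ℝ} (ht : t ∈ Set.Icc 0 T) :
    ∑ j ∈ Finset.range n, (j : ℝ) ^ r * f t j ≤
      m * Real.exp (r * (r - 1) * 2 ^ (r - 2) * A * t) := by
  set L : ℝ := (n : ℝ) ^ r
  have hL : 0 ≤ L := by positivity
  have hlim : Tendsto (fun M : ℕ => (m + L * ∫ s in (0 : ℝ)..T, b s (M + 2)) *
      Real.exp (r * (r - 1) * 2 ^ (r - 2) * A * t)) atTop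
      (nhds (m * Real.exp (r * (r - 1) * 2 ^ (r - 2) * A * t))) := by
    have := (tendsto_add_atTop_iff_nat 2).mpr (tendsto_integral_flux hT hA hint hb hbf hB)
    simpa using ((this.const_mul L).const_add m).mul_const _
  refine ge_of_tendsto hlim ?_
  filter_upwards [eventually_ge_atTop n] with M hM
  have hMr : L ≤ ((M + 1 : ℕ) : ℝ) ^ r :=
    Real.rpow_le_rpow (by positivity) (by exact_mod_cast hM.trans M.le_succ) (by linarith)
  refine le_trans ?_ (sum_truncatedPower_le hr hL hT hA hf hfc hint hb hbf hevol hm M hMr ht)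
  have hsub : Finset.range n ⊆ Finset.range (M + 2) := Finset.range_subset_range.mpr (by omega)
  calc ∑ j ∈ Finset.range n, (j : ℝ) ^ r * f t j
      = ∑ j ∈ Finset.range n, truncatedPower r L j * f t j := by
        refine Finset.sum_congr rfl fun j hj => ?_
        rw [truncatedPower, min_eq_left]
        exact Real.rpow_le_rpow (by positivity)
          (by exact_mod_cast (Finset.mem_range.mp hj).le) (by linarith)
    _ ≤ ∑ j ∈ Finset.range (M + 2), truncatedPower r L j * f t j :=
        Finset.sum_le_sum_of_subset_of_nonneg hsub fun j _ _ =>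
          mul_nonneg (truncatedPower_nonneg hL j) (hf t ht j)
    _ = _ := by
        rw [Finset.sum_range_succ' _ (M + 1)]
        simp [truncatedPower, Real.zero_rpow (show r ≠ 0 by linarith), hL]

/-- Lemma 4.1, propagation of moments: the local solution stays in
`Y_r^+`, with the explicit exponential bound `M_r(f(t)) ≤ M_r(f(0)) e^{C⋆ t}`. -/
theorem edg_moment_propagation (α C C1 r T0 : ℝ) (K : ℕ → ℕ → ℝ) (f0 : ℕ → ℝ)
    (f : ℝ → ℕ → ℝ)
    (hα : 1 < α) (hα2 : α ≤ 2) (hC : 0 < C) (hC1 : 0 < C1) (hr : 2 ≤ r)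
    (hKsym : ∀ j k : ℕ, K j k = K k j)
    (hKge : ∀ j k : ℕ, C1 * ((j : ℝ) ^ 2 * (k : ℝ) ^ α + (j : ℝ) ^ α * (k : ℝ) ^ 2) ≤ K j k)
    (hKle : ∀ j k : ℕ, K j k ≤ C * (j : ℝ) ^ 2 * (k : ℝ) ^ 2)
    (hf0 : MemYplus r f0) (hMr : 0 < mom r f0)
    (hT0 : 0 < T0) (hT0' : T0 < (2 * mom 2 f0 * C)⁻¹)
    (hfinit : f 0 = f0)
    (hsol : IsMildSolutionOn K 2 f (Set.Icc 0 T0))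
    (hM2bound : ∀ t ∈ Set.Icc (0:ℝ) T0, mom 2 (f t) ≤ ((mom 2 f0)⁻¹ - 2 * C * t)⁻¹) :
    ∀ t ∈ Set.Icc (0:ℝ) T0, MemYplus r (f t) ∧
      mom r (f t) ≤ mom r f0 *
        Real.exp (C * r * (r - 1) * (2:ℝ) ^ (r - 2) * mom 2 f0 /
          (1 - 2 * C * T0 * mom 2 f0) * t) := by
  obtain ⟨hY, hcont, -, hsum, hint, -, hevol⟩ := hsol
  have hTmem : T0 ∈ Set.Icc 0 T0 := ⟨hT0.le, le_rfl⟩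
  have hf : ∀ s ∈ Set.Icc 0 T0, ∀ j, 0 ≤ f s j := fun s hs => (hY s hs).1
  have hS2 : ∀ s ∈ Set.Icc 0 T0, Summable fun j : ℕ => (j : ℝ) ^ 2 * f s j := fun s hs => by
    simpa only [Real.rpow_two] using (hY s hs).2
  have hmom2 : ∀ g, mom 2 g = ∑' j : ℕ, (j : ℝ) ^ 2 * g j := fun g => by
    simp only [mom, Real.rpow_two]
  have hμ : 0 < mom 2 f0 := by
    by_contra! h
    have : (2 * mom 2 f0 * C)⁻¹ ≤ 0 := inv_nonpos.mpr (by nlinarith)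
    linarith
  set μ := mom 2 f0
  have hden : 0 < 1 - 2 * C * T0 * μ := by
    rw [← one_div, lt_div_iff₀ (by positivity)] at hT0'
    linarith
  set B := μ / (1 - 2 * C * T0 * μ) with hBdef
  have hB0 : 0 ≤ B := by positivity
  have hMB : ∀ s ∈ Set.Icc 0 T0, mom 2 (f s) ≤ B := by
    intro s hs
    refine (hM2bound s hs).trans ?_
    have hpos : 0 < μ⁻¹ - 2 * C * T0 := by
      have : μ⁻¹ - 2 * C * T0 = (1 - 2 * C * T0 * μ) / μ := by field_simp
      rw [this]
      positivity
    have hB : B = (μ⁻¹ - 2 * C * T0)⁻¹ := by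
      rw [hBdef, ← inv_div]
      congr 1
      field_simp
    rw [hB]
    refine inv_anti₀ hpos ?_
    have := mul_le_mul_of_nonneg_left hs.2 (by positivity : 0 ≤ 2 * C)
    linarith
  have hK : ∀ j k, 0 ≤ K j k := fun j k => le_trans (by positivity) (hKge j k)
  have hK0 : ∀ j, K 0 j = 0 := fun j => le_antisymm (by simpa using hKle 0 j) (hK 0 j)
  set a : ℝ → ℕ → ℝ := fun s j => ∑' k, K j k * f s k with ha
  have hloss : ∀ s ∈ Set.Icc 0 T0, ∀ j, ∑' k, K (k + 1) j * f s (k + 1) = a s j := by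
    intro s hs j
    rw [ha]
    dsimp only
    rw [(hsum s hs j).tsum_eq_zero_add, hKsym j 0, hK0 j, zero_mul, zero_add]
    exact tsum_congr fun k => by rw [hKsym]
  have ha0 : ∀ s ∈ Set.Icc 0 T0, ∀ j, 0 ≤ a s j := fun s hs j =>
    tsum_nonneg fun k => mul_nonneg (hK j k) (hf s hs k)
  have haB : ∀ s ∈ Set.Icc 0 T0, ∀ j, a s j ≤ C * (j : ℝ) ^ 2 * B := by
    intro s hs j
    calc a s j ≤ ∑' k : ℕ, C * (j : ℝ) ^ 2 * ((k : ℝ) ^ 2 * f s k) := by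
          refine (hsum s hs j).tsum_le_tsum (fun k => ?_) ((hS2 s hs).mul_left _)
          rw [← mul_assoc]
          exact mul_le_mul_of_nonneg_right (hKle j k) (hf s hs k)
      _ = C * (j : ℝ) ^ 2 * mom 2 (f s) := by rw [tsum_mul_left, hmom2]
      _ ≤ _ := mul_le_mul_of_nonneg_left (hMB s hs) (by positivity)
  have hpartial : ∀ n, ∑ j ∈ Finset.range n, (j : ℝ) ^ r * f 0 j ≤ mom r f0 := fun n => by
    rw [hfinit]
    exact hf0.2.sum_le_tsum _ fun j _ => mul_nonneg (by positivity) (hf0.1 j)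
  have hmain : ∀ n, ∀ t ∈ Set.Icc 0 T0, ∑ j ∈ Finset.range n, (j : ℝ) ^ r * f t j ≤
      mom r f0 * Real.exp (r * (r - 1) * 2 ^ (r - 2) * (C * B) * t) := by
    intro n t ht
    refine sum_rpow_mul_le (b := fun s j => f s j * a s j) (B := B) hr hT0.le (by positivity) hf
      hcont (fun j => ?_) (fun s hs j => mul_nonneg (hf s hs j) (ha0 s hs j)) (fun s hs j => ?_)
      (fun s hs n => ?_) (fun t ht j => ?_) hpartial n ht
    · rw [intervalIntegrable_iff_integrableOn_Icc_of_le hT0.le]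
      exact (hint T0 hTmem j).continuousOn_mul (hcont j) isCompact_Icc
    · have := mul_le_mul_of_nonneg_left (haB s hs j) (hf s hs j)
      linarith
    · refine le_trans ?_ (hMB s hs)
      rw [hmom2]
      exact (hS2 s hs).sum_le_tsum _ fun j _ => mul_nonneg (by positivity) (hf s hs j)
    · rw [hevol t ht j]
      congr 1
      refine intervalIntegral.integral_congr fun s hs => ?_
      rw [Set.uIcc_of_le ht.1] at hs
      have hs' : s ∈ Set.Icc 0 T0 := ⟨hs.1, hs.2.trans ht.2⟩
      simp only [hloss s hs']
      rfl
  intro t ht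
  have hnn : ∀ j : ℕ, 0 ≤ (j : ℝ) ^ r * f t j := fun j =>
    mul_nonneg (by positivity) (hf t ht j)
  refine ⟨⟨hf t ht, summable_of_sum_range_le hnn fun n => hmain n t ht⟩, ?_⟩
  have hrate : C * r * (r - 1) * (2 : ℝ) ^ (r - 2) * μ / (1 - 2 * C * T0 * μ) =
      r * (r - 1) * 2 ^ (r - 2) * (C * B) := by
    rw [hBdef]
    ring
  rw [hrate]
  exact Real.tsum_le_of_sum_range_le hnn fun n => hmain n t ht
end
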